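/- For every μ ∈ ℝ, τ > 0, γ ∈ [0,1] and α ≥ 0, with Z a standard normal random variable, E[η_soft(μ + τZ, γατ)²] = τ²·[(1 + ((γατ − μ)/τ)²)·Φ((μ − γατ)/τ) − ((γατ − μ)/τ)·φ((γατ − μ)/τ) + (1 + ((μ + γατ)/τ)²)·Φ(−(μ + γατ)/τ) − ((μ + γατ)/τ)·φ((μ + γατ)/τ)]; equivalently, writing b = γατ, E[η_soft(μ + τZ, b)²] = τ²·[T((b − μ)/τ) + T((b + μ)/τ)]. -/

import Mathlib

noncomputable section

/-- Soft-thresholding operator. -/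
def softThresh (x b : ℝ) : ℝ :=
  if x > b then x - b else if x < -b then x + b else 0

/-- Standard normal density `φ(z) = exp(−z²/2)/√(2π)`. -/
def gpdf (z : ℝ) : ℝ := Real.exp (-z ^ 2 / 2) / Real.sqrt (2 * Real.pi)

/-- Standard normal cumulative distribution function `Φ(z) = ∫_{−∞}^z φ(x) dx`. -/
def gcdf (z : ℝ) : ℝ := ∫ x in Set.Iic z, gpdf x

/-- `T(z) = (1 + z²)Φ(−z) − zφ(z)`. -/
def Tfun (z : ℝ) : ℝ := (1 + z ^ 2) * gcdf (-z) - z * gpdf z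

theorem integrable_pow_mul_gpdf (n : ℕ) : MeasureTheory.Integrable fun z : ℝ => z ^ n * gpdf z := by
  have h := (integrable_rpow_mul_exp_neg_mul_sq (b := 1 / 2) (by norm_num) (s := n)
    (by linarith [Nat.cast_nonneg (α := ℝ) n])).div_const (Real.sqrt (2 * Real.pi))
  refine h.congr (Filter.Eventually.of_forall fun z => ?_)
  simp only [Real.rpow_natCast, gpdf, mul_div_assoc]
  rw [show -(1 / 2 : ℝ) * z ^ 2 = -z ^ 2 / 2 by ring]

theorem hasDerivAt_gpdf (z : ℝ) : HasDerivAt gpdf (-z * gpdf z) z := by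
  have h : HasDerivAt (fun z : ℝ => -z ^ 2 / 2) (-z) z :=
    ((hasDerivAt_pow 2 z).neg.div_const 2).congr_deriv (by norm_num; ring)
  refine (h.exp.div_const (Real.sqrt (2 * Real.pi))).congr_deriv ?_
  rw [gpdf]
  ring

theorem gpdf_neg (z : ℝ) : gpdf (-z) = gpdf z := by
  simp [gpdf]

theorem gcdf_neg (c : ℝ) : gcdf (-c) = ∫ z in Set.Ioi c, gpdf z := by
  rw [gcdf, ← integral_comp_neg_Ioi]
  simp only [gpdf_neg]

theorem integrable_gpdf : MeasureTheory.Integrable gpdf := by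
  simpa using integrable_pow_mul_gpdf 0

theorem integrable_sub_sq_mul_gpdf (c : ℝ) :
    MeasureTheory.Integrable fun z : ℝ => (z - c) ^ 2 * gpdf z := by
  have h := ((integrable_pow_mul_gpdf 2).sub ((integrable_pow_mul_gpdf 1).const_mul (2 * c))).add
    (integrable_gpdf.const_mul (c ^ 2))
  refine h.congr (Filter.Eventually.of_forall fun z => ?_)
  simp only [Pi.add_apply, Pi.sub_apply]
  ring

theorem setIntegral_Ioi_sub_sq_mul_gpdf (c : ℝ) :
    ∫ z in Set.Ioi c, (z - c) ^ 2 * gpdf z = Tfun c := by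
  have hderiv (z : ℝ) : HasDerivAt (fun z => (2 * c - z) * gpdf z)
      ((z - c) ^ 2 * gpdf z - (1 + c ^ 2) * gpdf z) z :=
    (((hasDerivAt_id' z).const_sub (2 * c)).mul (hasDerivAt_gpdf z)).congr_deriv (by ring)
  have hint : MeasureTheory.Integrable fun z : ℝ => (2 * c - z) * gpdf z := by
    refine ((integrable_gpdf.const_mul (2 * c)).sub (integrable_pow_mul_gpdf 1)).congr
      (Filter.Eventually.of_forall fun z => ?_)
    simp only [Pi.sub_apply]
    ring
  have hsq := integrable_sub_sq_mul_gpdf c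
  have hpdf := integrable_gpdf.const_mul (1 + c ^ 2)
  have hlim := MeasureTheory.tendsto_zero_of_hasDerivAt_of_integrableOn_Ioi (a := c)
    (fun z _ => hderiv z) (hsq.sub hpdf).integrableOn hint.integrableOn
  have h := MeasureTheory.integral_Ioi_of_hasDerivAt_of_tendsto' (a := c)
    (fun z _ => hderiv z) (hsq.sub hpdf).integrableOn hlim
  rw [MeasureTheory.integral_sub hsq.integrableOn hpdf.integrableOn,
    MeasureTheory.integral_const_mul, ← gcdf_neg] at h
  rw [Tfun]
  linarith

theorem setIntegral_Iic_neg_add_sq_mul_gpdf (c : ℝ) :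
    ∫ z in Set.Iic (-c), (z + c) ^ 2 * gpdf z = Tfun c := by
  rw [← integral_comp_neg_Ioi, ← setIntegral_Ioi_sub_sq_mul_gpdf]
  congr 1 with z
  rw [gpdf_neg]
  ring

theorem softThresh_sq_eq_indicator_add {μ τ b : ℝ} (hτ : 0 < τ) (hb : 0 ≤ b) (z : ℝ) :
    softThresh (μ + τ * z) b ^ 2 * gpdf z =
      τ ^ 2 * ((Set.Ioi ((b - μ) / τ)).indicator (fun z => (z - (b - μ) / τ) ^ 2 * gpdf z) z +
        (Set.Iic (-((b + μ) / τ))).indicator (fun z => (z + (b + μ) / τ) ^ 2 * gpdf z) z) := by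
  have h₁ : z ∈ Set.Ioi ((b - μ) / τ) ↔ μ + τ * z > b := by
    rw [Set.mem_Ioi, div_lt_iff₀ hτ]
    constructor <;> intro h <;> linarith
  have h₂ : z ∈ Set.Iic (-((b + μ) / τ)) ↔ μ + τ * z ≤ -b := by
    rw [Set.mem_Iic, ← neg_div, le_div_iff₀ hτ]
    constructor <;> intro h <;> linarith
  simp only [Set.indicator_apply, h₁, h₂, softThresh]
  rcases lt_or_ge b (μ + τ * z) with h | h
  · rw [if_pos h, if_pos h, if_neg (by linarith)]
    field_simp
    ring
  · rw [if_neg h.not_gt, if_neg h.not_gt]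
    rcases lt_trichotomy (μ + τ * z) (-b) with h' | h' | h'
    · rw [if_pos h', if_pos h'.le]
      field_simp
      ring
    · have hz : z + (b + μ) / τ = 0 := by
        field_simp
        linarith
      simp [h', hz]
    · rw [if_neg h'.not_gt, if_neg h'.not_ge]
      simp

theorem integral_softThresh_sq_mul_gpdf {μ τ b : ℝ} (hτ : 0 < τ) (hb : 0 ≤ b) :
    ∫ z : ℝ, softThresh (μ + τ * z) b ^ 2 * gpdf z =
      τ ^ 2 * (Tfun ((b - μ) / τ) + Tfun ((b + μ) / τ)) := by
  have hadd : MeasureTheory.Integrable fun z : ℝ => (z + (b + μ) / τ) ^ 2 * gpdf z := by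
    simpa using integrable_sub_sq_mul_gpdf (-((b + μ) / τ))
  simp_rw [softThresh_sq_eq_indicator_add hτ hb]
  rw [MeasureTheory.integral_const_mul, MeasureTheory.integral_add
      ((integrable_sub_sq_mul_gpdf _).indicator measurableSet_Ioi)
      (hadd.indicator measurableSet_Iic),
    MeasureTheory.integral_indicator measurableSet_Ioi,
    MeasureTheory.integral_indicator measurableSet_Iic,
    setIntegral_Ioi_sub_sq_mul_gpdf, setIntegral_Iic_neg_add_sq_mul_gpdf]

/-- second moment of the soft-thresholded Gaussian
`E[η_soft(μ + τZ, γατ)²]`, expressed by the Gaussian density/cdf and by `T`. -/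
theorem softThresh_second_moment (μ τ γ α : ℝ) (hτ : 0 < τ)
    (hγ0 : 0 ≤ γ) (hγ1 : γ ≤ 1) (hα : 0 ≤ α) :
    (∫ z : ℝ, (softThresh (μ + τ * z) (γ * α * τ)) ^ 2 * gpdf z)
        = τ ^ 2 * ((1 + ((γ * α * τ - μ) / τ) ^ 2) * gcdf ((μ - γ * α * τ) / τ)
            - ((γ * α * τ - μ) / τ) * gpdf ((γ * α * τ - μ) / τ)
            + (1 + ((μ + γ * α * τ) / τ) ^ 2) * gcdf (-((μ + γ * α * τ) / τ))
            - ((μ + γ * α * τ) / τ) * gpdf ((μ + γ * α * τ) / τ)) ∧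
      (∫ z : ℝ, (softThresh (μ + τ * z) (γ * α * τ)) ^ 2 * gpdf z)
        = τ ^ 2 * (Tfun ((γ * α * τ - μ) / τ) + Tfun ((γ * α * τ + μ) / τ)) := by
  have h := integral_softThresh_sq_mul_gpdf (μ := μ) hτ (mul_nonneg (mul_nonneg hγ0 hα) hτ.le)
  refine ⟨?_, h⟩
  rw [h, Tfun, Tfun, ← neg_div, neg_sub, add_comm (γ * α * τ) μ]
  ring
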